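/- Let A be a central simple F-algebra, C ∈ A invertible, and suppose u, v, g, h ∈ A with g, h invertible, such that for all A' ∈ A: u·C·A'·C^{-1} − g·C·A'·C^{-1}·g^{-1}·u = C·(v·A' − h·A'·h^{-1}·v)·C^{-1}, and additionally g = λ·C·h·C^{-1} for some λ ∈ F^×. Then there exists μ ∈ F such that u = C·v·C^{-1} + μ·g. -/

import Mathlib

/-- Isomorphism criterion for inner actions: if the intertwining
relation holds for all `A'` and `g = λ·C·h·C⁻¹` with `λ ≠ 0`, then
`u = C·v·C⁻¹ + μ·g` for some `μ ∈ F`. -/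
theorem stmt4 {F A : Type*} [Field F] [Ring A] [Algebra F A]
    (hcentral : ∀ z : A, (∀ b : A, z * b = b * z) → ∃ c : F, z = c • (1 : A))
    (hsimple : IsSimpleRing A)
    (C g h : Aˣ) (u v : A) (lam : F) (hlam : lam ≠ 0)
    (hg : (g : A) = lam • ((C : A) * (h : A) * (↑C⁻¹ : A)))
    (hrel : ∀ A' : A,
      u * ((C : A) * A' * (↑C⁻¹ : A))
        - (g : A) * ((C : A) * A' * (↑C⁻¹ : A)) * (↑g⁻¹ : A) * u
      = (C : A) * (v * A' - (h : A) * A' * (↑h⁻¹ : A) * v) * (↑C⁻¹ : A)) :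
    ∃ μ : F, u = (C : A) * v * (↑C⁻¹ : A) + μ • (g : A) := by
  have hgC : (g : A) * C = lam • ((C : A) * h) := by
    rw [hg, smul_mul_assoc, mul_assoc, Units.inv_mul, mul_one]
  have hgC' : (↑g⁻¹ : A) * C = lam⁻¹ • ((C : A) * (↑h⁻¹ : A)) := by
    rw [Units.inv_mul_eq_iff_eq_mul, mul_smul_comm, ← mul_assoc, hgC, smul_mul_assoc,
      mul_assoc, Units.mul_inv, mul_one, smul_smul, inv_mul_cancel₀ hlam, one_smul]
  have hconj (a : A) : (C : A) * ((h : A) * a * (↑h⁻¹ : A) * v) * (↑C⁻¹ : A)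
      = (g : A) * ((C : A) * a * (↑C⁻¹ : A)) * (↑g⁻¹ : A) * ((C : A) * v * (↑C⁻¹ : A)) := by
    calc (C : A) * ((h : A) * a * (↑h⁻¹ : A) * v) * (↑C⁻¹ : A)
        = (lam • ((C : A) * h)) * a * (↑C⁻¹ : A) * (lam⁻¹ • ((C : A) * (↑h⁻¹ : A))) * v
            * (↑C⁻¹ : A) := by
          simp only [smul_mul_assoc, mul_smul_comm, smul_smul, inv_mul_cancel₀ hlam, one_smul,
            mul_assoc, Units.inv_mul_cancel_left]
      _ = _ := by rw [← hgC, ← hgC']; simp only [mul_assoc]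
  obtain ⟨μ, hμ⟩ := hcentral ((↑g⁻¹ : A) * (u - (C : A) * v * (↑C⁻¹ : A))) fun b => by
    have hb : (C : A) * ((↑C⁻¹ : A) * b * C) * (↑C⁻¹ : A) = b := by
      simp only [mul_assoc, Units.mul_inv, mul_one, Units.mul_inv_cancel_left]
    have hvb : (C : A) * (v * ((↑C⁻¹ : A) * b * C)) * (↑C⁻¹ : A)
        = (C : A) * v * (↑C⁻¹ : A) * b := by
      simp only [mul_assoc, Units.mul_inv, mul_one]
    have key := hrel ((↑C⁻¹ : A) * b * C)
    rw [mul_sub, sub_mul, hconj, hvb, hb, sub_eq_sub_iff_sub_eq_sub, ← sub_mul,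
      ← mul_sub] at key
    rw [mul_assoc, key]
    simp only [mul_assoc, Units.inv_mul_cancel_left]
  refine ⟨μ, ?_⟩
  rw [Units.inv_mul_eq_iff_eq_mul, mul_smul_comm, mul_one] at hμ
  rw [← hμ, add_sub_cancel]
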